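/- Let F be a field of characteristic 2 and E = F(α) a simple quartic extension with normalized minimal polynomial f(X) = X⁴ + aX³ + bX² + cX + d of α (b = 0, a ≠ 0 in the separable case; a = c = 0, b ≠ 0 in the inseparable not purely inseparable case; a = b = c = 0 in the purely inseparable case). Let φ be an anisotropic nonsingular quadratic form over F whose Witt class lies in W_q(E/F), and suppose dim φ = 4, or dim φ > 4 and dim φ ≡ 2 (mod 4). Then there exist a 2-fold quadratic Pfister form π with Witt class in W_q(E/F) and a 3-dimensional Pfister neighbor ψ of π such that ψ is dominated by φ. -/

import Mathlib

open QuadraticMap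

variable (F : Type) [Field F]

/-- Quadratic forms on `Fin n → F`. -/
abbrev QF (n : ℕ) := QuadraticForm F (Fin n → F)

/-- The nonsingular binary quadratic form `[a,b] = a x² + x y + b y²`. -/
noncomputable def binQF (a b : F) : QF F 2 :=
  (Matrix.of ![![a, 1], ![0, b]]).toQuadraticMap'

/-- The totally singular diagonal quadratic form `⟨c₁, …, c_n⟩ = Σ cᵢ xᵢ²`. -/
noncomputable def diagQF {n : ℕ} (c : Fin n → F) : QF F n :=
  QuadraticMap.weightedSumSquares F c

/-- Orthogonal sum of a finite family of quadratic forms of the same dimension. -/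
noncomputable def oSumFam {k n : ℕ} (q : Fin k → QF F n) : QF F (k * n) :=
  (QuadraticMap.pi q).comp
    ((LinearEquiv.curry F F (Fin k) (Fin n)).toLinearMap.comp
      (LinearEquiv.funCongrLeft F F finProdFinEquiv).toLinearMap)

/-- Orthogonal sum of two quadratic forms. -/
noncomputable def oSum {n m : ℕ} (q₁ : QF F n) (q₂ : QF F m) : QF F (n + m) :=
  (QuadraticMap.prod q₁ q₂).comp
    ((LinearEquiv.sumArrowLequivProdArrow (Fin n) (Fin m) F F).toLinearMap.comp
      (LinearEquiv.funCongrLeft F F finSumFinEquiv).toLinearMap)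

section General
variable {M N : Type} [AddCommGroup M] [Module F M] [AddCommGroup N] [Module F N]

/-- Two quadratic forms are isometric if there is an isometry (isomorphism preserving the
form) between them. -/
def QIsometric (q₁ : QuadraticForm F M) (q₂ : QuadraticForm F N) : Prop :=
  Nonempty (QuadraticMap.IsometryEquiv q₁ q₂)

/-- `q₁` is dominated by `q₂` (written `q₁ ≺ q₂`) if there is an injective linear map `t`
with `q₁ x = q₂ (t x)` for all `x`. -/
def Dominates (q₁ : QuadraticForm F M) (q₂ : QuadraticForm F N) : Prop :=
  ∃ t : M →ₗ[F] N, Function.Injective t ∧ ∀ x, q₁ x = q₂ (t x)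

/-- A quadratic form is nonsingular if the radical of its polar form is trivial. -/
def Nonsingular (q : QuadraticForm F M) : Prop :=
  ∀ x, (∀ y, polar q x y = 0) → x = 0

/-- A quadratic form is totally singular if its polar form vanishes identically. -/
def TotallySingular (q : QuadraticForm F M) : Prop :=
  ∀ x y, polar q x y = 0

/-- A quadratic form is hyperbolic if it is isometric to an orthogonal sum of
hyperbolic planes `ℍ = [0,0]`. -/
def Hyperbolic (q : QuadraticForm F M) : Prop :=
  ∃ k : ℕ, QIsometric F q (oSumFam F fun _ : Fin k => binQF F 0 0)

/-- Witt equivalence: two quadratic forms are Witt equivalent iff they have isometric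
anisotropic parts, i.e. both are isometric to `i × ℍ ⊥ ρ ⊥ j × ⟨0⟩` for a common
anisotropic form `ρ`. -/
def WittEquiv (q₁ : QuadraticForm F M) (q₂ : QuadraticForm F N) : Prop :=
  ∃ (r : ℕ) (ρ : QF F r), ρ.Anisotropic ∧
    (∃ i j : ℕ, QIsometric F q₁
      (oSum F (oSum F (oSumFam F fun _ : Fin i => binQF F 0 0) ρ) (diagQF F (0 : Fin j → F)))) ∧
    (∃ i j : ℕ, QIsometric F q₂
      (oSum F (oSum F (oSumFam F fun _ : Fin i => binQF F 0 0) ρ) (diagQF F (0 : Fin j → F))))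

end General

/-- The Gram-type matrix of a quadratic form on `Fin n → F`: diagonal entries are the values
on basis vectors, above-diagonal entries the polar values. -/
noncomputable def qMat {n : ℕ} (q : QF F n) : Matrix (Fin n) (Fin n) F :=
  Matrix.of fun i j =>
    if i = j then q (Pi.single i 1)
    else if i < j then polar q (Pi.single i 1) (Pi.single j 1) else 0

/-- Scalar extension of a quadratic form along `F → E`. -/
noncomputable def extQF (E : Type) [CommRing E] [Algebra F E] {n : ℕ} (q : QF F n) :
    QuadraticForm E (Fin n → E) :=
  ((qMat F q).map (algebraMap F E)).toQuadraticMap'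

/-- Membership of the Witt class of `q` in the kernel `W_q(E/F)` of `W_qF → W_qE`:
the scalar extension of `q` is Witt equivalent to the zero form. -/
def InWqKernel (E : Type) [Field E] [Algebra F E] {n : ℕ} (q : QF F n) : Prop :=
  WittEquiv E (extQF F E q) (0 : QF E 0)

/-- The 2-fold quadratic Pfister form `⟨⟨g,h]] = ⟨1,g⟩_b ⊗ [1,h] = [1,h] ⊥ g[1,h]`. -/
noncomputable def pf2 (g h : F) : QF F 4 :=
  oSum F (binQF F 1 h) (g • binQF F 1 h)

/-- The 3-fold quadratic Pfister form `⟨⟨g₁,g₂,h]] = ⟨1,g₁⟩_b ⊗ ⟨1,g₂⟩_b ⊗ [1,h]`. -/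
noncomputable def pf3 (g₁ g₂ h : F) : QF F 8 :=
  oSum F (pf2 F g₂ h) (g₁ • pf2 F g₂ h)

/-- Orthogonal sum of a list of quadratic forms of varying dimensions. -/
noncomputable def listOSum : List (Σ n, QF F n) → Σ n, QF F n
  | [] => ⟨0, 0⟩
  | x :: L => ⟨x.1 + (listOSum L).1, oSum F x.2 (listOSum L).2⟩

/-- The cubic resolvent `f_C(X) = X³ + bX² + acX + (a²d + c²)` of
`f(X) = X⁴ + aX³ + bX² + cX + d`, evaluated at `e`. -/
def cubicResolvent (a b c d e : F) : F := e ^ 3 + b * e ^ 2 + a * c * e + (a ^ 2 * d + c ^ 2)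


/-- The bilinear form with Gram matrix `qMat F q` over `F`, or its scalar extension. -/
noncomputable def extBilin {F : Type} [Field F] (E : Type) [CommRing E] [Algebra F E] {n : ℕ}
    (q : QF F n) : LinearMap.BilinForm E (Fin n → E) :=
  Matrix.toLinearMap₂' E ((qMat F q).map (algebraMap F E))

/-- Coordinatewise scalar extension of vectors. -/
def extVec {F : Type} [Field F] (E : Type) [CommRing E] [Algebra F E] (n : ℕ) :
    (Fin n → F) →ₗ[F] (Fin n → E) :=
  (Algebra.linearMap F E).compLeft (Fin n)

section ScalarExtension

variable {F E : Type} [Field F] [Field E] [Algebra F E] {n : ℕ}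

theorem extQF_eq_extBilin (q : QF F n) (x : Fin n → E) :
    extQF F E q x = extBilin E q x x := rfl

theorem extVec_apply (v : Fin n → F) (i : Fin n) : extVec E n v i = algebraMap F E (v i) := rfl

theorem self_eq_extBilin (q : QF F n) (v : Fin n → F) : q v = extBilin F q v v := by
  conv_lhs => rw [← QuadraticMap.toQuadraticMap_toBilin q (Pi.basisFun F (Fin n))]
  have : q.toBilin (Pi.basisFun F (Fin n)) = extBilin F q := by
    refine LinearMap.BilinForm.ext_basis (Pi.basisFun F (Fin n)) fun i j => ?_
    rw [QuadraticMap.toBilin_apply, Pi.basisFun_apply, Pi.basisFun_apply, extBilin,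
      Matrix.toLinearMap₂'_apply]
    simp [Pi.single_apply i, Pi.single_apply j]
    rfl
  rw [this]; rfl

theorem extBilin_extVec (q : QF F n) (u v : Fin n → F) :
    extBilin E q (extVec E n u) (extVec E n v) = algebraMap F E (extBilin F q u v) := by
  simp [extBilin, Matrix.toLinearMap₂'_apply, extVec_apply]

theorem polar_eq_extBilin (q : QF F n) (u v : Fin n → F) :
    polar q u v = extBilin F q u v + extBilin F q v u := by
  simp only [polar, self_eq_extBilin, map_add, LinearMap.add_apply]
  ring

theorem extQF_smul_extVec (q : QF F n) (x : E) (u : Fin n → F) :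
    extQF F E q (x • extVec E n u) = algebraMap F E (q u) * x ^ 2 := by
  rw [extQF_eq_extBilin]
  simp only [self_eq_extBilin q, map_smul, LinearMap.smul_apply,
    extBilin_extVec, smul_eq_mul]
  ring

theorem extQF_combination (q : QF F n) (x y z : E) (u v w : Fin n → F) :
    extQF F E q (x • extVec E n u + y • extVec E n v + z • extVec E n w) =
      algebraMap F E (q u) * x ^ 2 + algebraMap F E (q v) * y ^ 2 + algebraMap F E (q w) * z ^ 2
      + algebraMap F E (polar q u v) * (x * y) + algebraMap F E (polar q u w) * (x * z)
      + algebraMap F E (polar q v w) * (y * z) := by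
  rw [extQF_eq_extBilin]
  simp only [polar_eq_extBilin q, self_eq_extBilin q, map_smul, map_add,
    LinearMap.add_apply, LinearMap.smul_apply, extBilin_extVec, smul_eq_mul]
  ring

end ScalarExtension

theorem binQF_apply {F : Type} [Field F] (a b : F) (v : Fin 2 → F) :
    binQF F a b v = a * v 0 ^ 2 + v 0 * v 1 + b * v 1 ^ 2 := by
  change Matrix.toLinearMap₂' F (Matrix.of ![![a, 1], ![0, b]]) v v = _
  simp [Matrix.toLinearMap₂'_apply, Fin.sum_univ_two]
  ring

theorem oSum_apply {F : Type} [Field F] {n m : ℕ} (p : QF F n) (q : QF F m)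
    (v : Fin (n + m) → F) :
    oSum F p q v = p (fun i => v (Fin.castAdd m i)) + q (fun i => v (Fin.natAdd n i)) := rfl

theorem oSumFam_apply {F : Type} [Field F] {k n : ℕ} (q : Fin k → QF F n)
    (v : Fin (k * n) → F) :
    oSumFam F q v = ∑ i, q i (fun j => v (finProdFinEquiv (i, j))) := by
  simp only [oSumFam, QuadraticMap.comp_apply, QuadraticMap.pi_apply]
  rfl

theorem pf2_apply {F : Type} [Field F] (g h : F) (v : Fin 4 → F) :
    pf2 F g h v = v 0 ^ 2 + v 0 * v 1 + h * v 1 ^ 2 + g * (v 2 ^ 2 + v 2 * v 3 + h * v 3 ^ 2) := by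
  have := oSum_apply (binQF F 1 h) (g • binQF F 1 h) v
  rw [pf2, this]
  simp only [smul_apply, binQF_apply, smul_eq_mul, one_mul]
  rfl

theorem extQF_pf2_apply {F E : Type} [Field F] [Field E] [Algebra F E] (g h : F)
    (v : Fin 4 → E) :
    extQF F E (pf2 F g h) v = v 0 ^ 2 + v 0 * v 1 + algebraMap F E h * v 1 ^ 2
      + algebraMap F E g * (v 2 ^ 2 + v 2 * v 3 + algebraMap F E h * v 3 ^ 2) := by
  rw [extQF_eq_extBilin]
  simp [extBilin, Matrix.toLinearMap₂'_apply, Fin.sum_univ_four, qMat, polar, pf2_apply,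
    Pi.single_apply]
  ring

theorem inWqKernel_of_hyperbolic_coordinates {F E : Type} [Field F] [Field E] [Algebra F E]
    (q : QF F 4) (e : (Fin 4 → E) →ₗ[E] (Fin 4 → E)) (he : ∀ v, e v = 0 → v = 0)
    (hq : ∀ v, extQF F E q v = e v 0 * e v 1 + e v 2 * e v 3) : InWqKernel F E q := by
  refine ⟨0, 0, fun x _ => Subsingleton.elim _ _, ⟨2, 0, ⟨?_⟩⟩, ⟨0, 0, ⟨?_⟩⟩⟩
  · refine ⟨LinearEquiv.ofInjectiveEndo e ((injective_iff_map_eq_zero e).2 he), fun v => ?_⟩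
    rw [hq]
    change oSum E (n := 2 * 2 + 0) (m := 0) _ _ (e v) = _
    rw [oSum_apply, oSum_apply, oSumFam_apply]
    simp only [Fin.sum_univ_two, binQF_apply, diagQF, QuadraticMap.weightedSumSquares_apply]
    simp
    rfl
  · refine ⟨LinearEquiv.refl E _, fun v => ?_⟩
    rw [Subsingleton.elim v 0, map_zero]
    exact map_zero _

/-- A nontrivial zero of `⟨⟨g,h]]` with vanishing last coordinate makes it hyperbolic. -/
theorem pf2_inWqKernel_of_isotropic {F E : Type} [Field F] [CharP F 2] [Field E] [Algebra F E]
    (g h : F) (hg : g ≠ 0) (x y z : E) (hne : ¬ (x = 0 ∧ y = 0 ∧ z = 0))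
    (h0 : x ^ 2 + x * y + algebraMap F E h * y ^ 2 + algebraMap F E g * z ^ 2 = 0) :
    InWqKernel F E (pf2 F g h) := by
  have hc : CharP E 2 := charP_of_injective_algebraMap (algebraMap F E).injective 2
  have h2 : (2 : E) = 0 := CharTwo.two_eq_zero
  have hg' : algebraMap F E g ≠ 0 := by simpa using hg
  set G := algebraMap F E g with hG
  set H := algebraMap F E h with hH
  by_cases hz : z = 0
  · have hy : y ≠ 0 := by
      rintro rfl
      simp_all
    obtain ⟨s, rfl⟩ : ∃ s, x = s * y := ⟨x / y, by field_simp⟩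
    have hs : H = s ^ 2 + s := by
      have : y ^ 2 * (s ^ 2 + s + H) = 0 := by rw [← h0, hz]; ring
      have := (mul_eq_zero.1 this).resolve_left (pow_ne_zero _ hy)
      linear_combination this - (s ^ 2 + s) * h2
    refine inWqKernel_of_hyperbolic_coordinates _
      (Matrix.toLin' !![1, s, 0, 0; 1, s + 1, 0, 0; 0, 0, G, G * s; 0, 0, 1, s + 1]) ?_ ?_
    · intro v hv
      have e0 := congrFun hv 0
      have e1 := congrFun hv 1
      have e2 := congrFun hv 2
      have e3 := congrFun hv 3
      simp [Matrix.mulVec, dotProduct, Fin.sum_univ_four] at e0 e1 e2 e3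
      have v1 : v 1 = 0 := by linear_combination e1 - e0
      have v3 : v 3 = 0 := by
        refine (mul_eq_zero.1 (?_ : G * v 3 = 0)).resolve_left hg'
        linear_combination G * e3 - e2
      have v0 : v 0 = 0 := by linear_combination e0 - s * v1
      have v2 : v 2 = 0 := by linear_combination e3 - (s + 1) * v3
      funext i
      fin_cases i <;> simp [v0, v1, v2, v3]
    · intro v
      rw [extQF_pf2_apply]
      simp [Matrix.mulVec, dotProduct, Fin.sum_univ_four]
      rw [← hG, ← hH, hs]
      linear_combination (- v 0 * v 1 * s - G * v 2 * v 3 * s) * h2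
  · obtain ⟨p, rfl⟩ : ∃ p, x = p * z := ⟨x / z, by field_simp⟩
    obtain ⟨r, rfl⟩ : ∃ r, y = r * z := ⟨y / z, by field_simp⟩
    have hs : G = p ^ 2 + p * r + H * r ^ 2 := by
      have : z ^ 2 * (p ^ 2 + p * r + H * r ^ 2 + G) = 0 := by rw [← h0]; ring
      have := (mul_eq_zero.1 this).resolve_left (pow_ne_zero _ hz)
      linear_combination this - (p ^ 2 + p * r + H * r ^ 2) * h2
    refine inWqKernel_of_hyperbolic_coordinates _
      (Matrix.toLin' !![1, 0, p, H * r; 1, 1, p, H * r; 0, 1, r, p + r;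
        0, H, H * r + p, H * (p + r) + H * r]) ?_ ?_
    · intro v hv
      have e0 := congrFun hv 0
      have e1 := congrFun hv 1
      have e2 := congrFun hv 2
      have e3 := congrFun hv 3
      simp [Matrix.mulVec, dotProduct, Fin.sum_univ_four] at e0 e1 e2 e3
      have v1 : v 1 = 0 := by linear_combination e1 - e0
      have z1 : r * v 2 + (p + r) * v 3 = 0 := by linear_combination e2 - v1
      have z0 : p * v 2 + H * r * v 3 = 0 := by linear_combination e3 - H * z1 - H * v1
      have v0 : v 0 = 0 := by linear_combination e0 - z0
      have v2 : v 2 = 0 := by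
        refine (mul_eq_zero.1 (?_ : G * v 2 = 0)).resolve_left hg'
        linear_combination v 2 * hs + (p + r) * z0 - H * r * z1 + H * r ^ 2 * v 2 * h2
      have v3 : v 3 = 0 := by
        refine (mul_eq_zero.1 (?_ : G * v 3 = 0)).resolve_left hg'
        linear_combination v 3 * hs - r * z0 + p * z1 + H * r ^ 2 * v 3 * h2
      funext i
      fin_cases i <;> simp [v0, v1, v2, v3]
    · intro v
      rw [extQF_pf2_apply]
      simp [Matrix.mulVec, dotProduct, Fin.sum_univ_four]
      rw [← hG, ← hH, hs]
      rw [← sub_eq_zero]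
      ring_nf
      reduce_mod_char!

theorem InWqKernel.exists_linearMap {F E : Type} [Field F] [Field E] [Algebra F E] {N : ℕ}
    {φ : QF F N} (hker : InWqKernel F E φ) :
    ∃ k, 2 * k ≤ N ∧ ∃ l : (Fin N → E) →ₗ[E] (Fin k → E), ∀ x, l x = 0 → extQF F E φ x = 0 := by
  obtain ⟨r, ρ, -, ⟨i, j, ⟨e⟩⟩, ⟨i', j', ⟨e'⟩⟩⟩ := hker
  have h1 := e.toLinearEquiv.finrank_eq
  have h2 := e'.toLinearEquiv.finrank_eq
  simp only [Module.finrank_fin_fun] at h1 h2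
  obtain rfl : r = 0 := by omega
  refine ⟨i, by omega, (LinearMap.funLeft E E fun k : Fin i =>
    Fin.castAdd j (Fin.castAdd 0 (finProdFinEquiv (k, (0 : Fin 2))))).comp
      e.toLinearEquiv.toLinearMap, fun x hx => ?_⟩
  rw [← e.map_app x, oSum_apply, oSum_apply, oSumFam_apply]
  have h3 : ρ (fun k => e x (Fin.castAdd j (Fin.natAdd (i * 2) k))) = 0 := by
    rw [Subsingleton.elim (fun k => e x (Fin.castAdd j (Fin.natAdd (i * 2) k))) 0, map_zero]
  rw [h3, Finset.sum_eq_zero]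
  · simp [diagQF, QuadraticMap.weightedSumSquares_apply]
  · intro k _
    have : e x (Fin.castAdd j (Fin.castAdd 0 (finProdFinEquiv (k, (0 : Fin 2))))) = 0 :=
      congrFun hx k
    rw [binQF_apply, this]
    ring

theorem apply_combination {F : Type} [Field F] {n : ℕ} (q : QF F n) (x y z : F)
    (u v w : Fin n → F) :
    q (x • u + y • v + z • w) = q u * x ^ 2 + q v * y ^ 2 + q w * z ^ 2
      + polar q u v * (x * y) + polar q u w * (x * z) + polar q v w * (y * z) := by
  simp only [polar_eq_extBilin q, self_eq_extBilin q, map_smul, map_add,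
    LinearMap.add_apply, LinearMap.smul_apply, smul_eq_mul]
  ring

/-- `φ` dominates a `3`-dimensional neighbor of a `2`-fold Pfister form split by `E`. -/
def DominatesSplitNeighbor {F : Type} [Field F] (E : Type) [Field E] [Algebra F E] {N : ℕ}
    (φ : QF F N) : Prop :=
  ∃ g h : F, g ≠ 0 ∧ InWqKernel F E (pf2 F g h) ∧
    ∃ ψ : QF F 3, (∃ x : F, x ≠ 0 ∧ Dominates F ψ (x • pf2 F g h)) ∧ Dominates F ψ φ

section Domination

variable {F E : Type} [Field F] [CharP F 2] [Field E] [Algebra F E] {N : ℕ} {φ : QF F N}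

theorem dominatesSplitNeighbor_of_isotropic_triple (han : φ.Anisotropic) {u v w : Fin N → F}
    (hli : ∀ p q r : F, p • u + q • v + r • w = 0 → p = 0 ∧ q = 0 ∧ r = 0)
    (hp : polar φ u v ≠ 0) {x y z : E} (hne : ¬ (x = 0 ∧ y = 0 ∧ z = 0))
    (h0 : extQF F E φ (x • extVec E N u + y • extVec E N v + z • extVec E N w) = 0) :
    DominatesSplitNeighbor E φ := by
  have hc : CharP E 2 := charP_of_injective_algebraMap (algebraMap F E).injective 2
  have h2 : (2 : F) = 0 := CharTwo.two_eq_zero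
  have hA : φ u ≠ 0 := fun h => by
    have := hli 1 0 0 (by simp [han _ h])
    simp at this
  obtain ⟨k, hk⟩ : ∃ k, polar φ u v = k * φ u := ⟨polar φ u v / φ u, by field_simp⟩
  have hk0 : k ≠ 0 := by
    rintro rfl
    simp [hk] at hp
  obtain ⟨m, hm⟩ : ∃ m, m * k = 1 := ⟨k⁻¹, inv_mul_cancel₀ hk0⟩
  have hm0 : m ≠ 0 := left_ne_zero_of_mul_eq_one hm
  obtain ⟨c, hcu⟩ : ∃ c, polar φ u w = c * (k * φ u) :=
    ⟨polar φ u w / (k * φ u), by field_simp⟩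
  obtain ⟨b, hbv⟩ : ∃ b, polar φ v w = b * (k * φ u) :=
    ⟨polar φ v w / (k * φ u), by field_simp⟩
  obtain ⟨h, hh⟩ : ∃ h, φ v = h * k ^ 2 * φ u := ⟨φ v / (k ^ 2 * φ u), by field_simp⟩
  obtain ⟨g, hg⟩ : ∃ g, φ (b • u + c • v + (1 : F) • w) = g * φ u :=
    ⟨φ (b • u + c • v + (1 : F) • w) / φ u, by field_simp⟩
  have hg0 : g ≠ 0 := by
    rintro rfl
    rw [zero_mul] at hg
    simpa using hli _ _ _ (han _ hg)
  have hw : φ w = φ u * (g + b ^ 2 + h * k ^ 2 * c ^ 2 + k * b * c) := by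
    rw [apply_combination, hk, hcu, hbv, hh] at hg
    linear_combination hg - (φ u * (b ^ 2 + h * k ^ 2 * c ^ 2 + 2 * k * b * c)) * h2
  let t : (Fin 3 → F) →ₗ[F] (Fin N → F) :=
    Fintype.linearCombination F ![u, m • v, b • u + c • v + (1 : F) • w]
  have ht : ∀ s, t s = (s 0 + b * s 2) • u + (m * s 1 + c * s 2) • v + s 2 • w := by
    intro s
    simp only [t, Fintype.linearCombination_apply, Fin.sum_univ_three]
    simp
    module
  refine ⟨g, h, hg0, ?_, φ.comp t, ⟨φ u, hA, ?_⟩, t, ?_, fun _ => rfl⟩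
  · refine pf2_inWqKernel_of_isotropic g h hg0 (x + algebraMap F E b * z)
      (algebraMap F E k * (y + algebraMap F E c * z)) z ?_ ?_
    · rintro ⟨hx, hy, rfl⟩
      exact hne ⟨by simpa using hx, by simpa [hk0] using hy, rfl⟩
    · rw [extQF_combination, hk, hcu, hbv, hw, hh] at h0
      simp only [map_mul, map_add, map_pow] at h0
      refine (mul_eq_zero.1 (?_ : algebraMap F E (φ u) * _ = 0)).resolve_left (by simpa using hA)
      rw [← h0, ← sub_eq_zero]
      ring_nf
      reduce_mod_char!
  · refine ⟨LinearMap.pi ![LinearMap.proj 0, LinearMap.proj 1, LinearMap.proj 2, 0], ?_, ?_⟩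
    · intro s s' hs
      funext i
      have h0 := congrFun hs 0
      have h1 := congrFun hs 1
      have h2 := congrFun hs 2
      simp at h0 h1 h2
      fin_cases i <;> simp [h0, h1, h2]
    · intro s
      rw [smul_apply, pf2_apply, QuadraticMap.comp_apply, ht, apply_combination, hk, hcu,
        hbv, hw, hh]
      simp
      have hm2 : k ^ 2 * m ^ 2 = 1 := by rw [← mul_pow, mul_comm, hm, one_pow]
      rw [← sub_eq_zero]
      linear_combination φ u * s 0 * s 1 * hm + φ u * h * s 1 ^ 2 * hm2 + φ u * (s 0 * s 2 * (b + k * c) +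
        s 1 * s 2 * (b * k * m + h * k ^ 2 * m * c)
        + s 2 ^ 2 * (2 * b * k * c + b ^ 2 + h * k ^ 2 * c ^ 2)) * h2
  · rw [injective_iff_map_eq_zero]
    intro s hs
    rw [ht] at hs
    obtain ⟨e0, e1, e2⟩ := hli _ _ _ hs
    rw [e2, mul_zero, add_zero] at e0 e1
    have e1 := (mul_eq_zero.1 e1).resolve_left hm0
    funext i
    fin_cases i <;> simp [e0, e1, e2]

theorem dominatesSplitNeighbor_of_isotropic_pair (hN : 3 ≤ N) (han : φ.Anisotropic)
    (hns : Nonsingular F φ) {u v : Fin N → F}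
    (hli : ∀ p q : F, p • u + q • v = 0 → p = 0 ∧ q = 0) {x y : E} (hne : ¬ (x = 0 ∧ y = 0))
    (h0 : extQF F E φ (x • extVec E N u + y • extVec E N v) = 0) :
    DominatesSplitNeighbor E φ := by
  by_cases hp : polar φ u v = 0
  · have hu : u ≠ 0 := fun h => by simpa using hli 1 0 (by simp [h])
    obtain ⟨w, hw⟩ : ∃ w, polar φ u w ≠ 0 := by
      by_contra! hcon
      exact hu (hns u hcon)
    have huu : polar φ u u = 0 := by
      rw [QuadraticMap.polar_self, two_smul, CharTwo.add_self_eq_zero]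
    refine dominatesSplitNeighbor_of_isotropic_triple (u := u) (v := w) (w := v) (x := x) (y := 0)
      (z := y) han ?_ hw (by tauto) (by simpa using h0)
    intro p q r h
    have hq : q = 0 := by
      have := congrArg (polar φ u) h
      simpa [QuadraticMap.polar_add_right, QuadraticMap.polar_smul_right, huu, hp, hw] using this
    have := hli p r (by simpa [hq] using h)
    tauto
  · obtain ⟨w, hw⟩ : ∃ w, w ∉ Submodule.span F {u, v} := by
      by_contra! hcon
      have h1 : Submodule.span F {u, v} = ⊤ := by
        rw [eq_top_iff]
        exact fun w _ => hcon w
      have h3 : Module.finrank F (Submodule.span F {u, v}) ≤ 2 := by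
        classical
        have := finrank_span_finset_le_card (R := F) ({u, v} : Finset (Fin N → F))
        simp only [Finset.coe_insert, Finset.coe_singleton] at this
        exact this.trans Finset.card_le_two
      rw [h1, finrank_top, Module.finrank_fin_fun] at h3
      omega
    refine dominatesSplitNeighbor_of_isotropic_triple (u := u) (v := v) (w := w) (x := x) (y := y)
      (z := 0) han ?_ hp (by tauto) (by simpa using h0)
    intro p q r h
    have hr : r = 0 := by
      by_contra hr
      refine hw (Submodule.mem_span_pair.2 ⟨-p / r, -q / r, ?_⟩)
      have : w = (1 / r) • (r • w) := by rw [smul_smul, one_div_mul_cancel hr, one_smul]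
      rw [this, ← sub_eq_zero, ← neg_eq_zero, ← smul_zero (1 / r), ← h]
      module
    have := hli p q (by simpa [hr] using h)
    tauto

theorem dominatesSplitNeighbor_of_isotropic_vector (hN : 3 ≤ N) (han : φ.Anisotropic)
    (hns : Nonsingular F φ) {u v : Fin N → F} (hu : u ≠ 0) {x y : E}
    (hne : ∀ s : F, x + algebraMap F E s * y ≠ 0)
    (h0 : extQF F E φ (x • extVec E N u + y • extVec E N v) = 0) :
    DominatesSplitNeighbor E φ := by
  by_cases hli : ∀ p q : F, p • u + q • v = 0 → p = 0 ∧ q = 0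
  · refine dominatesSplitNeighbor_of_isotropic_pair hN han hns hli (fun h => hne 0 ?_) h0
    simp [h.1]
  · push Not at hli
    obtain ⟨p, q, hpq, h⟩ := hli
    have hq : q ≠ 0 := by
      rintro rfl
      have : p = 0 := by simpa [hu] using hpq
      exact h this rfl
    obtain ⟨s, rfl⟩ : ∃ s, v = s • u := by
      refine ⟨-p / q, ?_⟩
      have : v = (1 / q) • (q • v) := by rw [smul_smul, one_div_mul_cancel hq, one_smul]
      rw [this, eq_neg_of_add_eq_zero_right hpq]
      module
    have h1 : x • extVec E N u + y • extVec E N (s • u)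
        = (x + algebraMap F E s * y) • extVec E N u := by
      rw [map_smul, ← algebraMap_smul E s (extVec E N u)]
      module
    rw [h1, extQF_smul_extVec] at h0
    have := (mul_eq_zero.1 h0).resolve_right (pow_ne_zero _ (hne s))
    exact absurd (han u (by simpa using this)) hu

end Domination

section CommutingSquareRoots

variable {F V : Type} [Field F] [AddCommGroup V] [Module F V] {A B : V →ₗ[F] V} {d e : F}

theorem linearIndependent_four_of_three (hBB : ∀ v, B (B v) = e • v)
    (hli : ∀ v, v ≠ 0 → ∀ p q r : F, p • A v + q • B v + r • v = 0 → p = 0 ∧ q = 0 ∧ r = 0)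
    {v : V} (hv : v ≠ 0) {p q r s : F} (h : p • v + q • A v + r • B v + s • A (B v) = 0) :
    p = 0 ∧ q = 0 ∧ r = 0 ∧ s = 0 := by
  by_cases hs : s = 0
  · have := hli v hv q r p (by rw [← h, hs]; module)
    tauto
  exfalso
  obtain ⟨k, rfl⟩ : ∃ k, p = s * k := ⟨p / s, by field_simp⟩
  obtain ⟨y, rfl⟩ : ∃ y, q = s * y := ⟨q / s, by field_simp⟩
  obtain ⟨z, rfl⟩ : ∃ z, r = s * z := ⟨r / s, by field_simp⟩
  have h1 : k • v + y • A v + z • B v + A (B v) = 0 := by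
    refine (smul_eq_zero.1 (?_ : s • (k • v + y • A v + z • B v + A (B v)) = 0)).resolve_left hs
    rw [← h]
    module
  have hv' : B v + y • v ≠ 0 := fun h0 => by
    simpa using hli v hv 0 1 y (by simpa using h0)
  have hBv : B (B v + y • v) - y • (B v + y • v) = (e - y ^ 2) • v := by
    rw [map_add, map_smul, hBB]
    module
  have hAv : A (B v + y • v) + z • (B v + y • v) = (y * z - k) • v := by
    rw [map_add, map_smul, eq_neg_of_add_eq_zero_right h1]
    module
  have hm : e - y ^ 2 = 0 := by
    refine (hli _ hv' (e - y ^ 2) (-(y * z - k)) ((e - y ^ 2) * z + (y * z - k) * y) ?_).1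
    have : (e - y ^ 2) • (A (B v + y • v) + z • (B v + y • v))
        - (y * z - k) • (B (B v + y • v) - y • (B v + y • v)) = 0 := by
      rw [hBv, hAv]
      module
    rw [← this]
    module
  rw [hm, zero_smul] at hBv
  simpa using hli _ hv' 0 1 (-y) (by rw [← hBv]; module)

theorem linearCombination_four_apply (v : V) (c : Fin 4 → F) :
    Fintype.linearCombination F ![v, A v, B v, A (B v)] c
      = c 0 • v + c 1 • A v + c 2 • B v + c 3 • A (B v) := by
  simp [Fintype.linearCombination_apply, Fin.sum_univ_four]

theorem linearCombination_four_injective (hBB : ∀ v, B (B v) = e • v)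
    (hli : ∀ v, v ≠ 0 → ∀ p q r : F, p • A v + q • B v + r • v = 0 → p = 0 ∧ q = 0 ∧ r = 0)
    {v : V} (hv : v ≠ 0) :
    Function.Injective (Fintype.linearCombination F ![v, A v, B v, A (B v)]) := by
  rw [injective_iff_map_eq_zero]
  intro c hc
  rw [linearCombination_four_apply] at hc
  obtain ⟨h0, h1, h2, h3⟩ := linearIndependent_four_of_three hBB hli hv hc
  funext i
  fin_cases i <;> simp [h0, h1, h2, h3]

theorem four_dvd_finrank_of_commuting_square_roots [CharP F 2] [FiniteDimensional F V]
    (hAA : ∀ v, A (A v) = d • v) (hBB : ∀ v, B (B v) = e • v) (hcomm : ∀ v, A (B v) = B (A v))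
    (hli : ∀ v, v ≠ 0 → ∀ p q r : F, p • A v + q • B v + r • v = 0 → p = 0 ∧ q = 0 ∧ r = 0) :
    4 ∣ Module.finrank F V := by
  have hF2 : (2 : F) = 0 := CharTwo.two_eq_zero
  obtain ⟨S, ⟨hSA, hSB, hS4⟩, hmax⟩ := (wellFounded_gt (α := Submodule F V)).has_min
    {S | (∀ x ∈ S, A x ∈ S) ∧ (∀ x ∈ S, B x ∈ S) ∧ 4 ∣ Module.finrank F S}
    ⟨⊥, by simp, by simp, by simp⟩
  by_cases hS : S = ⊤
  · rwa [hS, finrank_top] at hS4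
  exfalso
  obtain ⟨v, hvS⟩ : ∃ v, v ∉ S := by
    by_contra! hcon
    exact hS (eq_top_iff.2 fun w _ => hcon w)
  have hv : v ≠ 0 := fun h => hvS (h ▸ S.zero_mem)
  set T := Fintype.linearCombination F ![v, A v, B v, A (B v)] with hT
  have hinj : Function.Injective T := linearCombination_four_injective hBB hli hv
  have hdisj : S ⊓ LinearMap.range T = ⊥ := by
    rw [Submodule.eq_bot_iff]
    rintro _ ⟨hxS, c, rfl⟩
    by_contra hx
    have hn : c 0 • T c + c 1 • A (T c) + c 2 • B (T c) + c 3 • A (B (T c))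
        = (c 0 ^ 2 + c 1 ^ 2 * d + c 2 ^ 2 * e + c 3 ^ 2 * d * e) • v := by
      rw [hT, linearCombination_four_apply]
      simp only [map_add, map_smul, ← hcomm, hAA, hBB]
      rw [← sub_eq_zero]
      have : (2 : F) • ((c 0 * c 1 + c 2 * c 3 * e) • A v + (c 0 * c 2 + c 1 * c 3 * d) • B v
          + (c 0 * c 3 + c 1 * c 2) • A (B v)) = 0 := by rw [hF2, zero_smul]
      rw [← this]
      module
    have hmem : (c 0 ^ 2 + c 1 ^ 2 * d + c 2 ^ 2 * e + c 3 ^ 2 * d * e) • v ∈ S := by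
      rw [← hn]
      have hxB := hSB _ hxS
      exact S.add_mem (S.add_mem (S.add_mem (S.smul_mem _ hxS) (S.smul_mem _ (hSA _ hxS)))
        (S.smul_mem _ hxB)) (S.smul_mem _ (hSA _ hxB))
    have h0 : c 0 ^ 2 + c 1 ^ 2 * d + c 2 ^ 2 * e + c 3 ^ 2 * d * e = 0 := by
      by_contra hne
      exact hvS ((S.smul_mem_iff hne).1 hmem)
    rw [h0, zero_smul] at hn
    obtain ⟨h0, h1, h2, h3⟩ := linearIndependent_four_of_three hBB hli hx hn
    refine hx ?_
    rw [hT, linearCombination_four_apply]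
    simp [h0, h1, h2, h3]
  refine hmax (S ⊔ LinearMap.range T) ⟨?_, ?_, ?_⟩ ?_
  · intro x hx
    obtain ⟨y, hy, _, ⟨c, rfl⟩, rfl⟩ := Submodule.mem_sup.1 hx
    rw [map_add]
    refine Submodule.add_mem_sup (hSA y hy) ⟨![d * c 1, c 0, d * c 3, c 2], ?_⟩
    rw [hT, linearCombination_four_apply, linearCombination_four_apply]
    simp only [map_add, map_smul, hAA]
    simp
    module
  · intro x hx
    obtain ⟨y, hy, _, ⟨c, rfl⟩, rfl⟩ := Submodule.mem_sup.1 hx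
    rw [map_add]
    refine Submodule.add_mem_sup (hSB y hy) ⟨![e * c 2, e * c 3, c 0, c 1], ?_⟩
    rw [hT, linearCombination_four_apply, linearCombination_four_apply]
    simp only [map_add, map_smul, ← hcomm, hBB]
    simp
    module
  · have := Submodule.finrank_sup_add_finrank_inf_eq S (LinearMap.range T)
    rw [hdisj, finrank_bot, LinearMap.finrank_range_of_inj hinj, Module.finrank_fin_fun] at this
    omega
  · refine lt_of_le_of_ne le_sup_left fun h => hvS ?_
    rw [h]
    refine Submodule.mem_sup_right ⟨Pi.single 0 1, ?_⟩
    rw [hT, linearCombination_four_apply]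
    simp

theorem finrank_of_orthogonal_similitudes [CharP F 2] [FiniteDimensional F V]
    (β : LinearMap.BilinForm F V) (halt : ∀ x, β x x = 0) (hsymm : ∀ x y, β x y = β y x)
    (hnd : ∀ x, (∀ y, β x y = 0) → x = 0)
    (hA : ∀ v, β (A v) v = 0) (hB : ∀ v, β (B v) v = 0) (hAB : ∀ v, β (A v) (B v) = 0)
    (hAA : ∀ v w, β (A v) (A w) = d * β v w) (hBB : ∀ v w, β (B v) (B w) = e * β v w)
    (hli : ∀ v, v ≠ 0 → ∀ p q r : F, p • A v + q • B v + r • v = 0 → p = 0 ∧ q = 0 ∧ r = 0) :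
    4 ∣ Module.finrank F V ∧ Module.finrank F V ≠ 4 := by
  have adj : ∀ C : V →ₗ[F] V, (∀ v, β (C v) v = 0) → ∀ v w, β (C v) w = β v (C w) := by
    intro C hC v w
    have := hC (v + w)
    simp only [map_add, LinearMap.add_apply, hC, zero_add, add_zero] at this
    rw [hsymm v]
    exact CharTwo.add_eq_zero.1 (by rw [← this]; ring)
  have hAA' : ∀ v, A (A v) = d • v := fun v => by
    rw [← sub_eq_zero]
    refine hnd _ fun w => ?_
    rw [map_sub, LinearMap.sub_apply, adj A hA, hAA]
    simp
  have hBB' : ∀ v, B (B v) = e • v := fun v => by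
    rw [← sub_eq_zero]
    refine hnd _ fun w => ?_
    rw [map_sub, LinearMap.sub_apply, adj B hB, hBB]
    simp
  have hcomm : ∀ v, A (B v) = B (A v) := fun v => by
    rw [← sub_eq_zero]
    refine hnd _ fun w => ?_
    have := hAB (v + w)
    simp only [map_add, LinearMap.add_apply, hAB, zero_add, add_zero] at this
    rw [map_sub, LinearMap.sub_apply, adj A hA (B v), adj B hB (A v), hsymm (B v), CharTwo.sub_eq_add]
    rw [← this]
  refine ⟨four_dvd_finrank_of_commuting_square_roots hAA' hBB' hcomm hli, fun h4 => ?_⟩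
  have : Nontrivial V := Module.nontrivial_of_finrank_pos (R := F) (by omega)
  obtain ⟨v, hv⟩ := exists_ne (0 : V)
  have hinj := linearCombination_four_injective hBB' hli hv
  have hsurj := (LinearMap.injective_iff_surjective_of_finrank_eq_finrank
    (by rw [h4, Module.finrank_fin_fun])).1 hinj
  refine hv (hnd v fun y => ?_)
  obtain ⟨c, rfl⟩ := hsurj y
  rw [linearCombination_four_apply]
  simp only [map_add, map_smul, halt, ← adj A hA v, ← adj B hB v, hA, hB, hAB]
  simp

end CommutingSquareRoots

section Quartic

variable {F E : Type} [Field F] [Field E] [Algebra F E] {α : E} {N : ℕ} {φ : QF F N}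

theorem coeff_eq_zero_of_quartic_generator (hdim : Module.finrank F E = 4)
    (hE : IntermediateField.adjoin F {α} = ⊤) {p q r s : F}
    (h : algebraMap F E p + algebraMap F E q * α + algebraMap F E r * α ^ 2
      + algebraMap F E s * α ^ 3 = 0) : p = 0 ∧ q = 0 ∧ r = 0 ∧ s = 0 := by
  have : FiniteDimensional F E := Module.finite_of_finrank_pos (by omega)
  have hdeg : (minpoly F α).natDegree = 4 := by
    rw [← IntermediateField.adjoin.finrank (Algebra.IsIntegral.isIntegral α), hE,
      IntermediateField.finrank_top', hdim]
  have hli := linearIndependent_pow (K := F) α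
  rw [hdeg, Fintype.linearIndependent_iff] at hli
  have hz := hli ![p, q, r, s] (by
    rw [← h]
    simp [Fin.sum_univ_four, Algebra.smul_def])
  exact ⟨hz 0, hz 1, hz 2, hz 3⟩

theorem exists_isotropic_family (hdim : Module.finrank F E = 4)
    (hE : IntermediateField.adjoin F {α} = ⊤) (han : φ.Anisotropic) (hker : InWqKernel F E φ) :
    ∃ A B : (Fin N → F) →ₗ[F] (Fin N → F), ∀ v,
      extQF F E φ ((1 : E) • extVec E N (A v) + α • extVec E N (B v)
        + α ^ 2 • extVec E N v) = 0 := by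
  have : FiniteDimensional F E := Module.finite_of_finrank_pos (by omega)
  obtain ⟨k, hk, l, hl⟩ := hker.exists_linearMap
  let V := Fin N → F
  let ι : (V × V × V) →ₗ[F] (Fin N → E) :=
    LinearMap.coprod (extVec E N) (LinearMap.coprod (α • extVec E N) (α ^ 2 • extVec E N))
  have hι : ∀ x, ι x = (1 : E) • extVec E N x.1 + α • extVec E N x.2.1
      + α ^ 2 • extVec E N x.2.2 := fun x => by
    simp [ι, add_assoc]
  let T : (V × V × V) →ₗ[F] (Fin k → E) := (l.restrictScalars F).comp ι
  have hT : ∀ x ∈ LinearMap.ker T, extQF F E φ (ι x) = 0 := fun x hx => hl _ hx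
  let P : LinearMap.ker T →ₗ[F] V :=
    ((LinearMap.snd F V V).comp (LinearMap.snd F V (V × V))).comp (LinearMap.ker T).subtype
  have hP : Function.Injective P := by
    rw [injective_iff_map_eq_zero]
    rintro ⟨⟨v₀, v₁, v₂⟩, hx⟩ h0
    obtain rfl : v₂ = 0 := h0
    have h1 := hT _ hx
    rw [hι, extQF_combination] at h1
    obtain ⟨h2, -, h3, -⟩ := coeff_eq_zero_of_quartic_generator hdim hE (p := φ v₀)
      (q := polar φ v₀ v₁) (r := φ v₁) (s := 0) (by
        rw [← h1]
        simp [QuadraticMap.polar_zero_right]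
        ring)
    simp [han _ h2, han _ h3]
  have hrank : Module.finrank F (LinearMap.ker T) = Module.finrank F V := by
    have h1 := LinearMap.finrank_range_add_finrank_ker T
    have h2 := Submodule.finrank_le (LinearMap.range T)
    have h3 := LinearMap.finrank_le_finrank_of_injective hP
    have h4 : Module.finrank F (Fin k → E) = k * 4 := by
      rw [Module.finrank_pi_fintype]
      simp [hdim]
    simp only [Module.finrank_prod, V, Module.finrank_fin_fun] at h1 h2 h3 ⊢
    omega
  let G := (LinearEquiv.ofBijective P ⟨hP, (LinearMap.injective_iff_surjective_of_finrank_eq_finrank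
    hrank).1 hP⟩).symm
  refine ⟨(LinearMap.fst F V (V × V)).comp ((LinearMap.ker T).subtype.comp G.toLinearMap),
    ((LinearMap.fst F V V).comp (LinearMap.snd F V (V × V))).comp
      ((LinearMap.ker T).subtype.comp G.toLinearMap), fun v => ?_⟩
  have h1 := hT _ (G v).2
  rw [hι] at h1
  have h2 : (G v).1.2.2 = v := G.symm_apply_apply v
  rw [h2] at h1
  exact h1

theorem dominatesSplitNeighbor_of_linear_relation [CharP F 2] (hdim : Module.finrank F E = 4)
    (hE : IntermediateField.adjoin F {α} = ⊤) (hN : 3 ≤ N) (han : φ.Anisotropic)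
    (hns : Nonsingular F φ) {u v w : Fin N → F} (hw : w ≠ 0)
    (h0 : extQF F E φ ((1 : E) • extVec E N u + α • extVec E N v + α ^ 2 • extVec E N w) = 0)
    {p q r : F} (hpqr : p • u + q • v + r • w = 0) (hne : ¬ (p = 0 ∧ q = 0 ∧ r = 0)) :
    DominatesSplitNeighbor E φ := by
  by_cases hp : p = 0
  · have hq : q ≠ 0 := by
      rintro rfl
      have : r = 0 := by simpa [hp, hw] using hpqr
      exact hne ⟨hp, rfl, this⟩
    obtain ⟨m, rfl⟩ : ∃ m, v = m • w := by
      refine ⟨-r / q, ?_⟩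
      have : v = (1 / q) • (q • v) := by rw [smul_smul, one_div_mul_cancel hq, one_smul]
      rw [hp, zero_smul, zero_add] at hpqr
      rw [this, eq_neg_of_add_eq_zero_left hpqr]
      module
    refine dominatesSplitNeighbor_of_isotropic_vector hN han hns (u := w) (v := u)
      (x := α ^ 2 + algebraMap F E m * α) (y := 1) hw (fun s hs => ?_) ?_
    · have := coeff_eq_zero_of_quartic_generator hdim hE (p := s) (q := m) (r := 1) (s := 0)
        (by rw [← hs]; simp; ring)
      simp at this
    · rw [← h0, map_smul (extVec E N), ← algebraMap_smul E m (extVec E N w)]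
      congr 1
      module
  · obtain ⟨m, n, rfl⟩ : ∃ m n : F, u = m • v + n • w := by
      refine ⟨-q / p, -r / p, ?_⟩
      have : u = (1 / p) • (p • u) := by rw [smul_smul, one_div_mul_cancel hp, one_smul]
      rw [add_assoc] at hpqr
      rw [this, eq_neg_of_add_eq_zero_left hpqr]
      module
    refine dominatesSplitNeighbor_of_isotropic_vector hN han hns (u := w) (v := v)
      (x := α ^ 2 + algebraMap F E n) (y := α + algebraMap F E m) hw (fun s hs => ?_) ?_
    · have := coeff_eq_zero_of_quartic_generator hdim hE (p := n + s * m) (q := s) (r := 1)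
        (s := 0) (by rw [← hs]; simp; ring)
      simp at this
    · rw [← h0, map_add (extVec E N), map_smul (extVec E N), map_smul (extVec E N), ← algebraMap_smul E m (extVec E N v),
        ← algebraMap_smul E n (extVec E N w)]
      congr 1
      module

end Quartic

/-- let `E = F(α)` be a simple quartic extension in characteristic 2 with
normalized minimal polynomial, and let `φ` be anisotropic nonsingular with Witt class in
`W_q(E/F)` and `dim φ = 4`, or `dim φ > 4` and `dim φ ≡ 2 (mod 4)`.  Then there are a 2-fold
quadratic Pfister form `π = ⟨⟨g,h]]` with class in `W_q(E/F)` and a 3-dimensional Pfister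
neighbor `ψ` of `π` with `ψ ≺ φ`. -/
theorem stmt_7 (F : Type) [Field F] [CharP F 2] (E : Type) [Field E] [Algebra F E]
    (a b c d : F) (α : E)
    (hα : α ^ 4 + algebraMap F E a * α ^ 3 + algebraMap F E b * α ^ 2
        + algebraMap F E c * α + algebraMap F E d = 0)
    (hdim : Module.finrank F E = 4)
    (hE : IntermediateField.adjoin F {α} = ⊤)
    (hnorm : (b = 0 ∧ a ≠ 0) ∨ (a = 0 ∧ c = 0 ∧ b ≠ 0) ∨ (a = 0 ∧ b = 0 ∧ c = 0))
    (N : ℕ) (φ : QF F N) (han : φ.Anisotropic) (hns : Nonsingular F φ)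
    (hker : InWqKernel F E φ)
    (hN : N = 4 ∨ (4 < N ∧ N % 4 = 2)) :
    ∃ g h : F, g ≠ 0 ∧ InWqKernel F E (pf2 F g h) ∧
      ∃ ψ : QF F 3, (∃ x : F, x ≠ 0 ∧ Dominates F ψ (x • pf2 F g h)) ∧ Dominates F ψ φ := by
  have h3 : 3 ≤ N := by omega
  change DominatesSplitNeighbor E φ
  by_contra hcon
  obtain ⟨A, B, hiso⟩ := exists_isotropic_family hdim hE han hker
  have hli : ∀ v, v ≠ 0 → ∀ p q r : F, p • A v + q • B v + r • v = 0 →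
      p = 0 ∧ q = 0 ∧ r = 0 := by
    intro v hv p q r h
    by_contra hne
    exact hcon (dominatesSplitNeighbor_of_linear_relation hdim hE h3 han hns hv (hiso v) h hne)
  have hAB : ∀ v, polar φ (A v) (B v) = 0 := fun v => by
    by_contra hp
    have hv : v ≠ 0 := by rintro rfl; simp at hp
    exact hcon (dominatesSplitNeighbor_of_isotropic_triple han (hli v hv) hp (by simp) (hiso v))
  have hA : ∀ v, polar φ (A v) v = 0 := fun v => by
    by_contra hp
    have hv : v ≠ 0 := by rintro rfl; simp at hp
    refine hcon (dominatesSplitNeighbor_of_isotropic_triple (w := B v) (x := 1) (y := α ^ 2)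
      (z := α) han (fun p q r h => ?_) hp (by simp) ?_)
    · have := hli v hv p r q (by rw [← h]; abel)
      tauto
    · rw [← hiso v]
      congr 1
      abel
  have hB : ∀ v, polar φ (B v) v = 0 := fun v => by
    by_contra hp
    have hv : v ≠ 0 := by rintro rfl; simp at hp
    refine hcon (dominatesSplitNeighbor_of_isotropic_triple (w := A v) (x := α) (y := α ^ 2)
      (z := 1) han (fun p q r h => ?_) hp (by simp) ?_)
    · have := hli v hv r p q (by rw [← h]; abel)
      tauto
    · rw [← hiso v]
      congr 1
      abel
  have hφ : ∀ v, φ (A v) = d * φ v ∧ φ (B v) = b * φ v := fun v => by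
    have h1 := hiso v
    rw [extQF_combination, hAB, hA, hB] at h1
    obtain ⟨e0, -, e2, -⟩ := coeff_eq_zero_of_quartic_generator hdim hE (p := φ (A v) - d * φ v)
      (q := - c * φ v) (r := φ (B v) - b * φ v) (s := - a * φ v) (by
        simp only [map_sub, map_mul, map_neg, map_zero] at h1 ⊢
        linear_combination h1 - algebraMap F E (φ v) * hα)
    exact ⟨sub_eq_zero.1 e0, sub_eq_zero.1 e2⟩
  have hpol : ∀ (C : (Fin N → F) →ₗ[F] (Fin N → F)) (s : F), (∀ v, φ (C v) = s * φ v) →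
      ∀ v w, polar φ (C v) (C w) = s * polar φ v w := by
    intro C s hC v w
    rw [polar, polar, ← map_add, hC, hC, hC]
    ring
  have key := finrank_of_orthogonal_similitudes φ.polarBilin
    (fun x => by simp [QuadraticMap.polar_self, CharTwo.two_eq_zero])
    (fun x y => QuadraticMap.polar_comm φ x y) hns hA hB hAB
    (hpol A d fun v => (hφ v).1) (hpol B b fun v => (hφ v).2) hli
  rw [Module.finrank_fin_fun] at key
  omega
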